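/- For every index i with 1 ≤ i ≤ L−1 and every (t,α) ∈ ℝ × ℝ^{L−1}, the curvature coefficient R^0_{0i0}(t,α) equals −p_i'(t) A(t,α) B(t) P(t) / (N(t) B(t) + A(t,α)²)², where P(t) = Σ_{m=1}^{L−1} p_m(t) p_m'(t). -/

import Mathlib

/-!
Formalization of results from "A geometric approach to equilibrium selection":
the metric, Christoffel symbols and curvature of the equilibrium manifold of a
two-consumer exchange economy with `L` goods, parametrized by
`Φ(t,α) = (p_1(t),…,p_{L−1}(t), α_1,…,α_{L−1}, w(t) − Σ_m p_m(t) α_m)`.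

Indices run over `Fin L`, where the index `0` corresponds to the coordinate
`x_0 = t` and an index `i ≠ 0` corresponds to the coordinate `x_i = α_i`
(the component `α 0` of `α : Fin L → ℝ` is never used, so `α` is just a copy
of `ℝ^{L−1}` together with an irrelevant extra coordinate).
-/

open Matrix BigOperators

noncomputable section

namespace EqSelection

variable {L : ℕ}

/-- `A(t,α) = w'(t) − Σ_{m=1}^{L−1} p_m'(t) α_m`. -/
def eqA [NeZero L] (p : Fin L → ℝ → ℝ) (w : ℝ → ℝ) (t : ℝ) (α : Fin L → ℝ) : ℝ :=
  deriv w t - ∑ m ∈ Finset.univ \ {0}, deriv (p m) t * α m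

/-- `A'(t,α) = w''(t) − Σ_{m=1}^{L−1} p_m''(t) α_m`. -/
def eqA' [NeZero L] (p : Fin L → ℝ → ℝ) (w : ℝ → ℝ) (t : ℝ) (α : Fin L → ℝ) : ℝ :=
  deriv (deriv w) t - ∑ m ∈ Finset.univ \ {0}, deriv (deriv (p m)) t * α m

/-- `B(t) = Σ_{m=1}^{L−1} (p_m'(t))²`. -/
def eqB [NeZero L] (p : Fin L → ℝ → ℝ) (t : ℝ) : ℝ :=
  ∑ m ∈ Finset.univ \ {0}, (deriv (p m) t) ^ 2

/-- `N(t) = 1 + Σ_{m=1}^{L−1} (p_m(t))²`. -/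
def eqN [NeZero L] (p : Fin L → ℝ → ℝ) (t : ℝ) : ℝ :=
  1 + ∑ m ∈ Finset.univ \ {0}, (p m t) ^ 2

/-- `C(t) = Σ_{m=1}^{L−1} p_m'(t) p_m''(t)`. -/
def eqC [NeZero L] (p : Fin L → ℝ → ℝ) (t : ℝ) : ℝ :=
  ∑ m ∈ Finset.univ \ {0}, deriv (p m) t * deriv (deriv (p m)) t

/-- `P(t) = Σ_{m=1}^{L−1} p_m(t) p_m'(t)`. -/
def eqP [NeZero L] (p : Fin L → ℝ → ℝ) (t : ℝ) : ℝ :=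
  ∑ m ∈ Finset.univ \ {0}, p m t * deriv (p m) t

/-- The induced metric matrix `g(t,α)`: `g_{00} = B + A²`, `g_{0i} = g_{i0} = −p_i A`,
`g_{ij} = p_i p_j + δ_{ij}` for `i, j ≠ 0`. -/
def gMat [NeZero L] (p : Fin L → ℝ → ℝ) (w : ℝ → ℝ) (t : ℝ) (α : Fin L → ℝ) :
    Matrix (Fin L) (Fin L) ℝ :=
  Matrix.of fun i j =>
    if i = 0 then
      if j = 0 then eqB p t + (eqA p w t α) ^ 2 else -(p j t) * eqA p w t α
    else
      if j = 0 then -(p i t) * eqA p w t α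
      else p i t * p j t + (if i = j then 1 else 0)

/-- Partial derivative with respect to the coordinate `x_k`, where `x_0 = t`
and `x_i = α_i` for `i ≠ 0`. -/
def pder [NeZero L] (k : Fin L) (f : ℝ → (Fin L → ℝ) → ℝ) (t : ℝ) (α : Fin L → ℝ) : ℝ :=
  if k = 0 then deriv (fun s => f s α) t
  else deriv (fun s => f t (Function.update α k s)) (α k)

/-- Christoffel symbol
`Γ^k_{ij} = (1/2) Σ_{h=0}^{L−1} g^{hk} (∂g_{jh}/∂x_i + ∂g_{hi}/∂x_j − ∂g_{ij}/∂x_h)`,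
written `christoffel p w i j k`.  (Here `g^{hk}` denotes the entries of the inverse
matrix of `g`, i.e. of `(gMat p w t α)⁻¹`.) -/
def christoffel [NeZero L] (p : Fin L → ℝ → ℝ) (w : ℝ → ℝ) (i j k : Fin L)
    (t : ℝ) (α : Fin L → ℝ) : ℝ :=
  (1 / 2) * ∑ h : Fin L,
    (gMat p w t α)⁻¹ h k *
      (pder i (fun t' α' => gMat p w t' α' j h) t α
        + pder j (fun t' α' => gMat p w t' α' h i) t α
        - pder h (fun t' α' => gMat p w t' α' i j) t α)

/-- Curvature coefficient
`R^s_{ijk} = Σ_{m} Γ^m_{ik} Γ^s_{jm} − Σ_{m} Γ^m_{jk} Γ^s_{im} + ∂Γ^s_{ik}/∂x_j − ∂Γ^s_{jk}/∂x_i`,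
written `curvR p w i j k s`. -/
def curvR [NeZero L] (p : Fin L → ℝ → ℝ) (w : ℝ → ℝ) (i j k s : Fin L)
    (t : ℝ) (α : Fin L → ℝ) : ℝ :=
  (∑ m : Fin L, christoffel p w i k m t α * christoffel p w j m s t α)
    - (∑ m : Fin L, christoffel p w j k m t α * christoffel p w i m s t α)
    + pder j (christoffel p w i k s) t α - pder i (christoffel p w j k s) t α

/-- The coordinate tangent vectors `Φ_i(t,α) ∈ ℝ^{2L−1}` of the parametrization
`Φ(t,α) = (p_1(t),…,p_{L−1}(t), α_1,…,α_{L−1}, w(t) − Σ_m p_m(t) α_m)`: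
`Φ_0 = (p_1',…,p_{L−1}', 0,…,0, A)`, and for `i ≠ 0` the vector `Φ_i` has entry `1`
in position `(L−1)+i` (1-indexed), entry `−p_i` in the last position and `0` elsewhere. -/
def PhiVec [NeZero L] (p : Fin L → ℝ → ℝ) (w : ℝ → ℝ) (i : Fin L)
    (t : ℝ) (α : Fin L → ℝ) : Fin (2 * L - 1) → ℝ :=
  fun j =>
    if i = 0 then
      if h : (j : ℕ) < L - 1 then deriv (p ⟨(j : ℕ) + 1, by omega⟩) t
      else if (j : ℕ) = 2 * L - 2 then eqA p w t α else 0
    else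
      if (j : ℕ) + 1 = (L - 1) + (i : ℕ) then 1
      else if (j : ℕ) = 2 * L - 2 then -(p i t) else 0

/-- The matrix `M(t,α)` of Statement 2: `M_{00} = N`, `M_{0i} = M_{i0} = p_i A`,
`M_{ii} = (N − p_i²) B + A²`, `M_{ij} = −p_i p_j B` for `i ≠ j`, `i, j ≠ 0`. -/
def invNumer [NeZero L] (p : Fin L → ℝ → ℝ) (w : ℝ → ℝ) (t : ℝ) (α : Fin L → ℝ) :
    Matrix (Fin L) (Fin L) ℝ :=
  Matrix.of fun i j =>
    if i = 0 then
      if j = 0 then eqN p t else p j t * eqA p w t α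
    else
      if j = 0 then p i t * eqA p w t α
      else if i = j then (eqN p t - (p i t) ^ 2) * eqB p t + (eqA p w t α) ^ 2
      else -(p i t * p j t * eqB p t)

/-- The determinant `N B + A²` of the metric. -/
def detG [NeZero L] (p : Fin L → ℝ → ℝ) (w : ℝ → ℝ) (t : ℝ) (α : Fin L → ℝ) : ℝ :=
  eqN p t * eqB p t + (eqA p w t α) ^ 2

section Algebra

variable [NeZero L] (p : Fin L → ℝ → ℝ) (w : ℝ → ℝ) (t : ℝ) (α : Fin L → ℝ)

theorem sum_univ_eq_zero_add (f : Fin L → ℝ) :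
    ∑ h, f h = f 0 + ∑ h ∈ Finset.univ \ {0}, f h := by
  rw [← Finset.sum_sdiff (Finset.subset_univ {(0 : Fin L)}), Finset.sum_singleton, add_comm]

theorem detG_pos (h : 0 < eqB p t ∨ deriv w t ≠ 0) : 0 < detG p w t α := by
  have hN : 0 < eqN p t := by unfold eqN; positivity
  have hB : 0 ≤ eqB p t := by unfold eqB; positivity
  rcases hB.lt_or_eq with hB | hB
  · unfold detG; positivity
  · have hp' : ∀ m ∈ Finset.univ \ {(0 : Fin L)}, deriv (p m) t * α m = 0 := by
      intro m hm
      have := (Finset.sum_eq_zero_iff_of_nonneg fun i _ => sq_nonneg (deriv (p i) t)).1 hB.symm m hm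
      rw [pow_eq_zero_iff two_ne_zero] at this
      rw [this, zero_mul]
    have hA : eqA p w t α = deriv w t := by
      rw [eqA, Finset.sum_eq_zero hp', sub_zero]
    have hw' : deriv w t ≠ 0 := h.resolve_left (by rw [← hB]; exact lt_irrefl 0)
    rw [detG, ← hB, hA]
    positivity

theorem gMat_symm (i j : Fin L) : gMat p w t α i j = gMat p w t α j i := by
  by_cases hi : i = 0 <;> by_cases hj : j = 0 <;> simp [gMat, hi, hj, eq_comm, mul_comm]

theorem invNumer_of_ne {i j : Fin L} (hi : i ≠ 0) (hj : j ≠ 0) :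
    invNumer p w t α i j =
      -(p i t * p j t * eqB p t) + if i = j then detG p w t α else 0 := by
  by_cases h : i = j
  · subst h
    simp only [invNumer, of_apply, hi, if_false, if_true, detG]
    ring
  · simp [invNumer, hi, hj, h]

theorem sum_sq_eq : ∑ m ∈ Finset.univ \ {0}, p m t * p m t = eqN p t - 1 := by
  simp [eqN, sq]

theorem sum_mul_invNumer {k : Fin L} (hk : k ≠ 0) :
    ∑ h ∈ Finset.univ \ {0}, p h t * invNumer p w t α h k
      = p k t * (eqB p t + eqA p w t α ^ 2) := by
  have : ∀ h ∈ Finset.univ \ {(0 : Fin L)}, p h t * invNumer p w t α h k =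
      (p h t * p h t) * (-(p k t * eqB p t)) + if h = k then p h t * detG p w t α else 0 := by
    intro h hh
    rw [invNumer_of_ne p w t α (by simpa using hh) hk]
    split_ifs <;> ring
  rw [Finset.sum_congr rfl this, Finset.sum_add_distrib, ← Finset.sum_mul, sum_sq_eq,
    Finset.sum_ite_eq', if_pos (by simpa using hk), detG]
  ring

theorem sum_mul_invNumer_zero :
    ∑ h ∈ Finset.univ \ {0}, p h t * invNumer p w t α h 0 = (eqN p t - 1) * eqA p w t α := by
  rw [← sum_sq_eq, Finset.sum_mul]
  refine Finset.sum_congr rfl fun h hh => ?_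
  have : h ≠ 0 := by simpa using hh
  simp [invNumer, this, mul_assoc]

theorem gMat_mul_invNumer :
    gMat p w t α * invNumer p w t α = detG p w t α • (1 : Matrix (Fin L) (Fin L) ℝ) := by
  ext i k
  rw [mul_apply, sum_univ_eq_zero_add]
  by_cases hi : i = 0
  · subst hi
    have : ∀ h ∈ Finset.univ \ {(0 : Fin L)}, gMat p w t α 0 h * invNumer p w t α h k =
        -eqA p w t α * (p h t * invNumer p w t α h k) := by
      intro h hh
      have : h ≠ 0 := by simpa using hh
      simp only [gMat, of_apply, this, if_false, if_true]
      ring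
    rw [Finset.sum_congr rfl this, ← Finset.mul_sum]
    by_cases hk : k = 0
    · subst hk
      rw [sum_mul_invNumer_zero]
      simp [gMat, invNumer, detG]
      ring
    · rw [sum_mul_invNumer p w t α hk]
      simp [gMat, invNumer, hk, Ne.symm hk]
      ring
  · have : ∀ h ∈ Finset.univ \ {(0 : Fin L)}, gMat p w t α i h * invNumer p w t α h k =
        p i t * (p h t * invNumer p w t α h k) + if i = h then invNumer p w t α h k else 0 := by
      intro h hh
      have : h ≠ 0 := by simpa using hh
      simp only [gMat, of_apply, this, hi, if_false]
      split_ifs <;> ring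
    rw [Finset.sum_congr rfl this, Finset.sum_add_distrib, ← Finset.mul_sum,
      Finset.sum_ite_eq, if_pos (by simpa using hi)]
    by_cases hk : k = 0
    · subst hk
      rw [sum_mul_invNumer_zero]
      simp [gMat, invNumer, hi]
      ring
    · rw [sum_mul_invNumer p w t α hk, invNumer_of_ne p w t α hi hk]
      simp only [gMat, invNumer, of_apply, hi, hk, if_false, if_true, Matrix.smul_apply, one_apply,
        smul_eq_mul]
      split_ifs <;> ring

theorem gMat_inv (h : detG p w t α ≠ 0) :
    (gMat p w t α)⁻¹ = (detG p w t α)⁻¹ • invNumer p w t α := by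
  refine inv_eq_right_inv ?_
  rw [Matrix.mul_smul, gMat_mul_invNumer, smul_smul, inv_mul_cancel₀ h, one_smul]

/-- Contraction with the inverse metric of a covector `v` with `v_h = c p_h` for `h ≠ 0`. -/
theorem sum_gMat_inv_mul (hD : detG p w t α ≠ 0) (v : Fin L → ℝ) (c : ℝ)
    (hv : ∀ h ≠ 0, v h = c * p h t) (k : Fin L) :
    ∑ h, (gMat p w t α)⁻¹ h k * v h =
      if k = 0 then (eqN p t * v 0 + c * (eqN p t - 1) * eqA p w t α) / detG p w t α
      else p k t * (eqA p w t α * v 0 + c * (eqB p t + eqA p w t α ^ 2)) / detG p w t α := by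
  have : ∀ h ∈ Finset.univ \ {(0 : Fin L)}, (gMat p w t α)⁻¹ h k * v h =
      c / detG p w t α * (p h t * invNumer p w t α h k) := by
    intro h hh
    rw [hv h (by simpa using hh), gMat_inv p w t α hD, Matrix.smul_apply, smul_eq_mul]
    ring
  rw [sum_univ_eq_zero_add, Finset.sum_congr rfl this, ← Finset.mul_sum, gMat_inv p w t α hD,
    Matrix.smul_apply, smul_eq_mul]
  by_cases hk : k = 0
  · subst hk
    rw [sum_mul_invNumer_zero]
    simp only [invNumer, of_apply, if_true]
    ring
  · rw [sum_mul_invNumer p w t α hk]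
    simp only [invNumer, of_apply, hk, if_true, if_false]
    ring

theorem christoffel_symm (i j k : Fin L) :
    christoffel p w i j k t α = christoffel p w j i k t α := by
  simp only [christoffel, gMat_symm p w _ _ j i]
  congr 1
  refine Finset.sum_congr rfl fun h _ => ?_
  simp only [gMat_symm p w _ _ h i, gMat_symm p w _ _ h j]
  ring

end Algebra

section Derivatives

variable [NeZero L] {p : Fin L → ℝ → ℝ} {w : ℝ → ℝ}

theorem hasDerivAt_of_smooth {f : ℝ → ℝ} (hf : ContDiff ℝ (⊤ : ℕ∞) f) (t : ℝ) :
    HasDerivAt f (deriv f t) t :=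
  (hf.differentiable (by simp) t).hasDerivAt

theorem hasDerivAt_deriv_of_smooth {f : ℝ → ℝ} (hf : ContDiff ℝ (⊤ : ℕ∞) f) (t : ℝ) :
    HasDerivAt (deriv f) (deriv (deriv f) t) t :=
  hasDerivAt_of_smooth (contDiff_infty_iff_deriv.1 hf).2 t

theorem hasDerivAt_eqA (hp : ∀ i, ContDiff ℝ (⊤ : ℕ∞) (p i)) (hw : ContDiff ℝ (⊤ : ℕ∞) w)
    (t : ℝ) (α : Fin L → ℝ) : HasDerivAt (fun s => eqA p w s α) (eqA' p w t α) t :=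
  (hasDerivAt_deriv_of_smooth hw t).sub <| HasDerivAt.fun_sum fun m _ =>
    (hasDerivAt_deriv_of_smooth (hp m) t).mul_const (α m)

theorem hasDerivAt_eqB (hp : ∀ i, ContDiff ℝ (⊤ : ℕ∞) (p i)) (t : ℝ) :
    HasDerivAt (eqB p) (2 * eqC p t) t := by
  rw [eqC, Finset.mul_sum]
  refine HasDerivAt.fun_sum fun m _ => ?_
  refine HasDerivAt.congr_deriv ((hasDerivAt_deriv_of_smooth (hp m) t).pow 2) ?_
  norm_num
  ring

theorem hasDerivAt_eqN (hp : ∀ i, ContDiff ℝ (⊤ : ℕ∞) (p i)) (t : ℝ) :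
    HasDerivAt (eqN p) (2 * eqP p t) t := by
  rw [eqP, Finset.mul_sum]
  refine HasDerivAt.const_add 1 (HasDerivAt.fun_sum fun m _ => ?_)
  refine HasDerivAt.congr_deriv ((hasDerivAt_of_smooth (hp m) t).pow 2) ?_
  norm_num
  ring

theorem hasDerivAt_detG (hp : ∀ i, ContDiff ℝ (⊤ : ℕ∞) (p i)) (hw : ContDiff ℝ (⊤ : ℕ∞) w)
    (t : ℝ) (α : Fin L → ℝ) :
    HasDerivAt (fun s => detG p w s α)
      (2 * eqP p t * eqB p t + 2 * eqN p t * eqC p t + 2 * eqA p w t α * eqA' p w t α) t := by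
  refine HasDerivAt.congr_deriv (((hasDerivAt_eqN hp t).mul (hasDerivAt_eqB hp t)).add
    ((hasDerivAt_eqA hp hw t α).pow 2)) ?_
  norm_num
  ring

theorem hasDerivAt_sum_update (a : Fin L → ℝ) (α : Fin L → ℝ) {k : Fin L} (hk : k ≠ 0) (s : ℝ) :
    HasDerivAt (fun s => ∑ m ∈ Finset.univ \ {0}, a m * Function.update α k s m) (a k) s := by
  have h : ∀ m ∈ Finset.univ \ {(0 : Fin L)},
      HasDerivAt (fun s => a m * Function.update α k s m) (if m = k then a m else 0) s := by
    intro m _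
    by_cases hm : m = k
    · subst hm
      simpa using (hasDerivAt_id s).const_mul (a m)
    · simpa [hm] using hasDerivAt_const s (a m * α m)
  refine (HasDerivAt.fun_sum h).congr_deriv ?_
  rw [Finset.sum_ite_eq', if_pos (by simpa using hk)]

theorem hasDerivAt_eqA_update (p : Fin L → ℝ → ℝ) (w : ℝ → ℝ) (t : ℝ) (α : Fin L → ℝ)
    {k : Fin L} (hk : k ≠ 0) (s : ℝ) :
    HasDerivAt (fun s => eqA p w t (Function.update α k s)) (-deriv (p k) t) s :=
  (hasDerivAt_sum_update (fun m => deriv (p m) t) α hk s).const_sub (deriv w t)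

theorem hasDerivAt_eqA'_update (p : Fin L → ℝ → ℝ) (w : ℝ → ℝ) (t : ℝ) (α : Fin L → ℝ)
    {k : Fin L} (hk : k ≠ 0) (s : ℝ) :
    HasDerivAt (fun s => eqA' p w t (Function.update α k s)) (-deriv (deriv (p k)) t) s :=
  (hasDerivAt_sum_update (fun m => deriv (deriv (p m)) t) α hk s).const_sub (deriv (deriv w) t)

theorem hasDerivAt_detG_update (p : Fin L → ℝ → ℝ) (w : ℝ → ℝ) (t : ℝ) (α : Fin L → ℝ)
    {k : Fin L} (hk : k ≠ 0) :
    HasDerivAt (fun s => detG p w t (Function.update α k s))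
      (-2 * eqA p w t α * deriv (p k) t) (α k) := by
  refine HasDerivAt.congr_deriv (((hasDerivAt_eqA_update p w t α hk (α k)).pow 2).const_add
    (eqN p t * eqB p t)) ?_
  norm_num

theorem pder_zero_gMat_zero_zero (hp : ∀ i, ContDiff ℝ (⊤ : ℕ∞) (p i))
    (hw : ContDiff ℝ (⊤ : ℕ∞) w) (t : ℝ) (α : Fin L → ℝ) :
    pder 0 (fun t' α' => gMat p w t' α' 0 0) t α
      = 2 * eqC p t + 2 * eqA p w t α * eqA' p w t α := by
  simp only [pder, gMat, of_apply, if_true]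
  rw [((hasDerivAt_eqB hp t).fun_add ((hasDerivAt_eqA hp hw t α).fun_pow 2)).deriv]
  norm_num

theorem pder_zero_gMat_zero_right (hp : ∀ i, ContDiff ℝ (⊤ : ℕ∞) (p i))
    (hw : ContDiff ℝ (⊤ : ℕ∞) w) (t : ℝ) (α : Fin L → ℝ) {h : Fin L} (hh : h ≠ 0) :
    pder 0 (fun t' α' => gMat p w t' α' h 0) t α
      = -deriv (p h) t * eqA p w t α - p h t * eqA' p w t α := by
  simp only [pder, gMat, of_apply, if_true, hh, if_false]
  rw [((hasDerivAt_of_smooth (hp h) t).fun_neg.fun_mul (hasDerivAt_eqA hp hw t α)).deriv]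
  ring

theorem pder_zero_gMat_of_ne (hp : ∀ i, ContDiff ℝ (⊤ : ℕ∞) (p i))
    (t : ℝ) (α : Fin L → ℝ) {i j : Fin L} (hi : i ≠ 0) (hj : j ≠ 0) :
    pder 0 (fun t' α' => gMat p w t' α' i j) t α
      = deriv (p i) t * p j t + p i t * deriv (p j) t := by
  simp only [pder, gMat, of_apply, if_true, hi, hj, if_false]
  rw [(((hasDerivAt_of_smooth (hp i) t).fun_mul (hasDerivAt_of_smooth (hp j) t)).add_const _).deriv]

theorem pder_gMat_zero_zero (p : Fin L → ℝ → ℝ) (w : ℝ → ℝ) (t : ℝ) (α : Fin L → ℝ)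
    {k : Fin L} (hk : k ≠ 0) :
    pder k (fun t' α' => gMat p w t' α' 0 0) t α = -2 * eqA p w t α * deriv (p k) t := by
  simp only [pder, gMat, of_apply, if_true, hk, if_false]
  rw [(((hasDerivAt_eqA_update p w t α hk (α k)).fun_pow 2).const_add _).deriv]
  norm_num

theorem pder_gMat_zero_right (p : Fin L → ℝ → ℝ) (w : ℝ → ℝ) (t : ℝ) (α : Fin L → ℝ)
    {k h : Fin L} (hk : k ≠ 0) (hh : h ≠ 0) :
    pder k (fun t' α' => gMat p w t' α' h 0) t α = p h t * deriv (p k) t := by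
  simp only [pder, gMat, of_apply, if_true, hk, hh, if_false]
  rw [((hasDerivAt_eqA_update p w t α hk (α k)).const_mul _).deriv]
  ring

theorem pder_gMat_of_ne (p : Fin L → ℝ → ℝ) (w : ℝ → ℝ) (t : ℝ) (α : Fin L → ℝ)
    {k i j : Fin L} (hk : k ≠ 0) (hi : i ≠ 0) (hj : j ≠ 0) :
    pder k (fun t' α' => gMat p w t' α' i j) t α = 0 := by
  simp [pder, gMat, hk, hi, hj]

end Derivatives

section Christoffel

variable [NeZero L] {p : Fin L → ℝ → ℝ} {w : ℝ → ℝ}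

theorem christoffel_zero_zero_zero (hp : ∀ i, ContDiff ℝ (⊤ : ℕ∞) (p i))
    (hw : ContDiff ℝ (⊤ : ℕ∞) w) {t : ℝ} {α : Fin L → ℝ} (hD : detG p w t α ≠ 0) :
    christoffel p w 0 0 0 t α
      = (eqN p t * eqC p t + eqA p w t α * eqA' p w t α) / detG p w t α := by
  rw [christoffel, sum_gMat_inv_mul p w t α hD _ (-2 * eqA' p w t α), if_pos rfl,
    pder_zero_gMat_zero_zero hp hw]
  · ring
  · intro h hh
    simp only [gMat_symm p w _ _ 0 h]
    rw [pder_zero_gMat_zero_right hp hw t α hh, pder_gMat_zero_zero p w t α hh]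
    ring

theorem christoffel_right_zero (hp : ∀ i, ContDiff ℝ (⊤ : ℕ∞) (p i))
    (hw : ContDiff ℝ (⊤ : ℕ∞) w) {t : ℝ} {α : Fin L → ℝ} (hD : detG p w t α ≠ 0)
    {i : Fin L} (hi : i ≠ 0) (k : Fin L) :
    christoffel p w i 0 k t α
      = if k = 0 then -deriv (p i) t * eqA p w t α / detG p w t α
        else deriv (p i) t * p k t * eqB p t / detG p w t α := by
  rw [christoffel, sum_gMat_inv_mul p w t α hD _ (2 * deriv (p i) t)]
  · simp only [gMat_symm p w _ _ 0 i]
    rw [pder_gMat_zero_zero p w t α hi, pder_zero_gMat_zero_right hp hw t α hi]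
    split_ifs <;> ring
  · intro h hh
    simp only [gMat_symm p w _ _ 0 h]
    rw [pder_gMat_zero_right p w t α hi hh, pder_zero_gMat_of_ne hp t α hh hi,
      pder_gMat_zero_right p w t α hh hi]
    ring

theorem christoffel_of_ne (hp : ∀ i, ContDiff ℝ (⊤ : ℕ∞) (p i)) (t : ℝ) (α : Fin L → ℝ)
    {i j : Fin L} (hi : i ≠ 0) (hj : j ≠ 0) (k : Fin L) :
    christoffel p w i j k t α = 0 := by
  rw [christoffel, Finset.sum_eq_zero, mul_zero]
  intro h _
  by_cases hh : h = 0
  · subst hh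
    simp only [gMat_symm p w _ _ 0 i]
    rw [pder_gMat_zero_right p w t α hi hj, pder_gMat_zero_right p w t α hj hi,
      pder_zero_gMat_of_ne hp t α hi hj]
    ring
  · rw [pder_gMat_of_ne p w t α hi hj hh, pder_gMat_of_ne p w t α hj hh hi,
      pder_gMat_of_ne p w t α hh hi hj]
    ring

theorem pder_christoffel_zero_zero_zero (hp : ∀ i, ContDiff ℝ (⊤ : ℕ∞) (p i))
    (hw : ContDiff ℝ (⊤ : ℕ∞) w) (hD : ∀ t α, detG p w t α ≠ 0) (t : ℝ) (α : Fin L → ℝ)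
    {i : Fin L} (hi : i ≠ 0) :
    pder i (christoffel p w 0 0 0) t α
      = -(deriv (p i) t * eqA' p w t α + eqA p w t α * deriv (deriv (p i)) t) / detG p w t α
        + (eqN p t * eqC p t + eqA p w t α * eqA' p w t α) * (2 * eqA p w t α * deriv (p i) t)
          / detG p w t α ^ 2 := by
  have hΓ : christoffel p w 0 0 0 = fun t α =>
      (eqN p t * eqC p t + eqA p w t α * eqA' p w t α) / detG p w t α := by
    funext t α
    exact christoffel_zero_zero_zero hp hw (hD t α)
  have hderiv := (((hasDerivAt_eqA_update p w t α hi (α i)).fun_mul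
    (hasDerivAt_eqA'_update p w t α hi (α i))).const_add (eqN p t * eqC p t)).fun_div
    (hasDerivAt_detG_update p w t α hi) (hD _ _)
  rw [hΓ, pder, if_neg hi, hderiv.deriv, Function.update_eq_self]
  have := hD t α
  field_simp
  ring

theorem pder_zero_christoffel_right_zero_zero (hp : ∀ i, ContDiff ℝ (⊤ : ℕ∞) (p i))
    (hw : ContDiff ℝ (⊤ : ℕ∞) w) (hD : ∀ t α, detG p w t α ≠ 0) (t : ℝ) (α : Fin L → ℝ)
    {i : Fin L} (hi : i ≠ 0) :
    pder 0 (christoffel p w i 0 0) t α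
      = -(deriv (p i) t * eqA' p w t α + eqA p w t α * deriv (deriv (p i)) t) / detG p w t α
        + deriv (p i) t * eqA p w t α * (2 * eqP p t * eqB p t + 2 * eqN p t * eqC p t
          + 2 * eqA p w t α * eqA' p w t α) / detG p w t α ^ 2 := by
  have hΓ : christoffel p w i 0 0 = fun t α =>
      -deriv (p i) t * eqA p w t α / detG p w t α := by
    funext t α
    rw [christoffel_right_zero hp hw (hD t α) hi, if_pos rfl]
  have hderiv := ((hasDerivAt_deriv_of_smooth (hp i) t).fun_neg.fun_mul
    (hasDerivAt_eqA hp hw t α)).fun_div (hasDerivAt_detG hp hw t α) (hD _ _)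
  rw [hΓ, pder, if_pos rfl, hderiv.deriv]
  have := hD t α
  field_simp
  ring

end Christoffel

theorem statement_12 (L : ℕ) [NeZero L] (hL : 2 ≤ L)
    (p : Fin L → ℝ → ℝ) (w : ℝ → ℝ)
    (hp : ∀ i, ContDiff ℝ (⊤ : ℕ∞) (p i)) (hw : ContDiff ℝ (⊤ : ℕ∞) w)
    (hreg : ∀ t : ℝ, 0 < eqB p t ∨ deriv w t ≠ 0) :
    ∀ i : Fin L, i ≠ 0 →
      ∀ (t : ℝ) (α : Fin L → ℝ),
        curvR p w 0 i 0 0 t α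
          = -(deriv (p i) t) * eqA p w t α * eqB p t * eqP p t / (eqN p t * eqB p t + (eqA p w t α) ^ 2) ^ 2 := by
  intro i hi t α
  have hD : ∀ t α, detG p w t α ≠ 0 := fun t α => (detG_pos p w t α (hreg t)).ne'
  have hleft : ∀ m ∈ Finset.univ \ {(0 : Fin L)},
      christoffel p w 0 0 m t α * christoffel p w i m 0 t α = 0 := by
    intro m hm
    rw [christoffel_of_ne hp t α hi (by simpa using hm), mul_zero]
  have hright : ∀ m ∈ Finset.univ \ {(0 : Fin L)},
      christoffel p w i 0 m t α * christoffel p w 0 m 0 t α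
        = -(deriv (p i) t * eqA p w t α * eqB p t / detG p w t α ^ 2)
          * (p m t * deriv (p m) t) := by
    intro m hm
    have hm0 : m ≠ 0 := by simpa using hm
    rw [christoffel_symm p w t α 0 m, christoffel_right_zero hp hw (hD t α) hi,
      christoffel_right_zero hp hw (hD t α) hm0, if_neg hm0, if_pos rfl]
    ring
  rw [curvR, sum_univ_eq_zero_add, sum_univ_eq_zero_add, Finset.sum_eq_zero hleft,
    Finset.sum_congr rfl hright, ← Finset.mul_sum, ← eqP,
    pder_christoffel_zero_zero_zero hp hw hD t α hi,
    pder_zero_christoffel_right_zero_zero hp hw hD t α hi, ← detG]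
  ring

end EqSelection
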